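/- Every outer k-planar graph on n vertices has at most (2·√(k+1) + 2)·n edges. -/

import Mathlib

open scoped Classical

/-- A point in the plane. -/
abbrev Pt := EuclideanSpace ℝ (Fin 2)

/-- A finite point set is in convex position (convexly independent). -/
def ConvexPos (V : Finset Pt) : Prop :=
  ∀ p ∈ V, p ∉ convexHull ℝ ((V.erase p : Finset Pt) : Set Pt)

/-- The open straight-line segment drawn for an unordered pair of points. -/
noncomputable def edgeSeg (e : Sym2 Pt) : Set Pt :=
  Sym2.lift ⟨fun a b => openSegment ℝ a b, fun a b => openSegment_symm ℝ a b⟩ e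

/-- Two distinct edges cross if their open segments intersect. -/
def Cross (e f : Sym2 Pt) : Prop :=
  e ≠ f ∧ (edgeSeg e ∩ edgeSeg f).Nonempty

theorem Cross_comm (e f : Sym2 Pt) : Cross e f ↔ Cross f e := by
  unfold Cross
  rw [Set.inter_comm]
  exact and_congr_left' ne_comm

/-- A convex geometric graph: points in convex position, edges are unordered
pairs of distinct points of `V`. -/
structure ConvexGeomGraph where
  V : Finset Pt
  E : Finset (Sym2 Pt)
  convexPos : ConvexPos V
  not_diag : ∀ e ∈ E, ¬ e.IsDiag
  mem_V : ∀ e ∈ E, ∀ p ∈ e, p ∈ V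

/-- A convex geometric graph is outer `k`-planar if every edge crosses at
most `k` other edges. -/
noncomputable def OuterKPlanar (G : ConvexGeomGraph) (k : ℕ) : Prop :=
  ∀ e ∈ G.E, (G.E.filter (fun f => Cross e f)).card ≤ k

/-- Bipartite: vertices can be partitioned into `A` and `B` with every edge
joining a point of `A` to a point of `B`. -/
def Bipartite (G : ConvexGeomGraph) : Prop :=
  ∃ A B : Finset Pt, A ∪ B = G.V ∧ Disjoint A B ∧
    ∀ e ∈ G.E, ∃ a ∈ A, ∃ b ∈ B, e = s(a, b)

/-- The degree of a vertex: number of edges containing it. -/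
noncomputable def degree (G : ConvexGeomGraph) (v : Pt) : ℕ :=
  (G.E.filter (fun e => v ∈ e)).card

/-- The number of unordered pairs of distinct edges that cross. -/
noncomputable def crossingNumber (E : Finset (Sym2 Pt)) : ℕ :=
  (E.sym2.filter (fun pr => Sym2.lift
    ⟨fun e f => Cross e f, fun e f => propext (Cross_comm e f)⟩ pr)).card

/-- Twice the signed area of the triangle `abc`. -/
def orient (a b c : Pt) : ℝ :=
  (b 0 - a 0) * (c 1 - a 1) - (b 1 - a 1) * (c 0 - a 0)

theorem ConvexPos.mono {V W : Finset Pt} (hV : ConvexPos V) (h : W ⊆ V) : ConvexPos W :=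
  fun p hp hp' => hV p (h hp)
    (convexHull_mono (Finset.coe_subset.2 (Finset.erase_subset_erase p h)) hp')

/-- In convex position, no point is a convex combination of three other ones. -/
theorem ConvexPos.ne_combination {V : Finset Pt} (hV : ConvexPos V) {p a b c : Pt}
    (hp : p ∈ V) (ha : a ∈ V) (hb : b ∈ V) (hc : c ∈ V)
    (hap : a ≠ p) (hbp : b ≠ p) (hcp : c ≠ p) {x y z : ℝ}
    (hx : 0 ≤ x) (hy : 0 ≤ y) (hz : 0 ≤ z) (hsum : x + y + z = 1) :
    p ≠ x • a + y • b + z • c := by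
  intro h
  refine hV p hp ?_
  have hconv := convex_convexHull ℝ ((V.erase p : Finset Pt) : Set Pt)
  have hsub := subset_convexHull ℝ ((V.erase p : Finset Pt) : Set Pt)
  have key := hconv.sum_mem (t := Finset.univ) (w := ![x, y, z]) (z := ![a, b, c])
    (by intro i _; fin_cases i <;> simpa) (by simpa [Fin.sum_univ_three] using hsum)
    (by
      intro i _
      fin_cases i
      · exact hsub (by simp [hap, ha])
      · exact hsub (by simp [hbp, hb])
      · exact hsub (by simp [hcp, hc]))
  have hp' : p = ∑ i, ![x, y, z] i • ![a, b, c] i := by simpa [Fin.sum_univ_three] using h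
  rwa [← hp'] at key

/-- Seen from a vertex of a set in convex position, the triples of other vertices inherit
their orientation from the angular order. -/
theorem ConvexPos.orient_pos {V : Finset Pt} (hV : ConvexPos V) {p a b c : Pt}
    (hp : p ∈ V) (ha : a ∈ V) (hb : b ∈ V) (hc : c ∈ V)
    (hpb : p ≠ b) (hab : a ≠ b) (hcb : c ≠ b)
    (h₁ : 0 < orient p a b) (h₂ : 0 < orient p b c) (h₃ : 0 < orient p a c) :
    0 < orient a b c := by
  by_contra! h
  have e : orient a b c = orient p a b + orient p b c - orient p a c := by
    unfold orient; ring
  refine hV.ne_combination hb hp ha hc hpb hab hcb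
    (x := 1 - orient p b c / orient p a c - orient p a b / orient p a c)
    (y := orient p b c / orient p a c) (z := orient p a b / orient p a c)
    ?_ (by positivity) (by positivity) (by ring) ?_
  · rw [sub_sub, ← add_div, sub_nonneg, div_le_one h₃]; linarith
  · ext i
    fin_cases i <;> simp <;> field_simp <;> unfold orient <;> ring

/-- Two diagonals of a counterclockwise quadrilateral intersect. -/
theorem openSegment_inter_nonempty {a b c d : Pt} (h₁ : 0 < orient a b c)
    (h₂ : 0 < orient a b d) (h₃ : 0 < orient a c d) (h₄ : 0 < orient b c d) :
    (openSegment ℝ a c ∩ openSegment ℝ b d).Nonempty := by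
  have e : orient a c d + orient a b c = orient b c d + orient a b d := by
    unfold orient; ring
  have hS : 0 < orient b c d + orient a b d := by linarith
  refine ⟨(orient b c d / (orient b c d + orient a b d)) • a +
    (orient a b d / (orient b c d + orient a b d)) • c,
    ⟨_, _, by positivity, by positivity, by field_simp, rfl⟩,
    ⟨orient a c d / (orient b c d + orient a b d), orient a b c / (orient b c d + orient a b d),
      by positivity, by positivity, by rw [← add_div, e, div_self hS.ne'], ?_⟩⟩
  ext i
  fin_cases i <;> simp <;> field_simp <;> unfold orient <;> ring

/-- Points in convex position admit a real key whose order is a counterclockwise order. -/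
theorem ConvexPos.exists_key {V : Finset Pt} (hV : ConvexPos V) (hne : V.Nonempty) :
    ∃ φ : Pt → ℝ, Set.InjOn φ V ∧ ∀ a ∈ V, ∀ b ∈ V, ∀ c ∈ V,
      φ a < φ b → φ b < φ c → 0 < orient a b c := by
  obtain ⟨p, hp⟩ := hne
  obtain ⟨f, u, hfp, hf⟩ := geometric_hahn_banach_point_closed
    (convex_convexHull ℝ ((V.erase p : Finset Pt) : Set Pt))
    ((V.erase p).finite_toSet.isClosed_convexHull ℝ) (hV p hp)
  obtain ⟨α, β, hαβ⟩ : ∃ α β : ℝ, ∀ v : Pt, f v = α * v 0 + β * v 1 := by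
    refine ⟨f (EuclideanSpace.single 0 1), f (EuclideanSpace.single 1 1), fun v => ?_⟩
    have hv : v = v 0 • EuclideanSpace.single 0 (1 : ℝ) +
        v 1 • EuclideanSpace.single 1 (1 : ℝ) := by
      ext i; fin_cases i <;> simp
    conv_lhs => rw [hv]
    simp [mul_comm]
  set F : Pt → ℝ := fun q => α * (q 0 - p 0) + β * (q 1 - p 1) with hF
  set K : Pt → ℝ := fun q => α * (q 1 - p 1) - β * (q 0 - p 0) with hK
  have Fpos : ∀ q ∈ V, q ≠ p → 0 < F q := by
    intro q hq hqp
    have h1 := hf q (subset_convexHull ℝ _ (by simp [hq, hqp]))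
    rw [hαβ] at h1 hfp
    simp only [hF]; linarith
  have hdet : ∀ a b, (α ^ 2 + β ^ 2) * orient p a b = F a * K b - K a * F b := by
    intro a b; simp only [hF, hK, orient]; ring
  have hlt : ∀ a ∈ V, ∀ b ∈ V, a ≠ p → b ≠ p → K a / F a < K b / F b →
      0 < orient p a b := by
    intro a ha b hb hap hbp h
    rw [div_lt_div_iff₀ (Fpos a ha hap) (Fpos b hb hbp)] at h
    refine pos_of_mul_pos_right (a := α ^ 2 + β ^ 2) ?_ (by positivity)
    rw [hdet]; linarith
  have hinj_aux : ∀ a ∈ V, ∀ b ∈ V, a ≠ p → b ≠ p → K a / F a = K b / F b →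
      F a ≤ F b → a = b := by
    intro a ha b hb hap hbp h hle
    by_contra hab
    have pa := Fpos a ha hap
    have pb := Fpos b hb hbp
    rw [div_eq_div_iff pa.ne' pb.ne'] at h
    have hq : α ^ 2 + β ^ 2 ≠ 0 := by
      intro h0
      have h1 : α = 0 := by nlinarith [sq_nonneg α, sq_nonneg β]
      have h2 : β = 0 := by nlinarith [sq_nonneg α, sq_nonneg β]
      simp [hF, h1, h2] at pa
    have h0 : orient p a b = 0 := by
      have := hdet a b
      rw [show F a * K b - K a * F b = 0 by linarith] at this
      exact (mul_eq_zero.1 this).resolve_left hq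
    refine hV.ne_combination ha hp hb hb (Ne.symm hap) (Ne.symm hab) (Ne.symm hab)
      (x := 1 - F a / F b) (y := F a / F b) (z := 0)
      (by rw [sub_nonneg, div_le_one pb]; exact hle) (by positivity) le_rfl (by ring) ?_
    unfold orient at h0
    ext i
    fin_cases i <;> simp <;> field_simp <;> simp only [hF]
    · linear_combination β * h0
    · linear_combination -α * h0
  obtain ⟨M, hM⟩ : ∃ M, ∀ q ∈ V, M < K q / F q := by
    obtain ⟨M, hM⟩ := (V.image fun q => K q / F q).finite_toSet.bddBelow
    exact ⟨M - 1, fun q hq => by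
      have := hM (Finset.mem_coe.2 (Finset.mem_image_of_mem (fun q => K q / F q) hq))
      linarith⟩
  refine ⟨fun q => if q = p then M else K q / F q, ?_, ?_⟩
  · intro a ha b hb h
    by_cases hap : a = p <;> by_cases hbp : b = p
    · rw [hap, hbp]
    · simp only [hap, hbp, if_true, if_false] at h
      exact absurd h (hM b hb).ne
    · simp only [hap, hbp, if_true, if_false] at h
      exact absurd h (hM a ha).ne'
    · simp only [hap, hbp, if_false] at h
      rcases le_total (F a) (F b) with hle | hle
      · exact hinj_aux a ha b hb hap hbp h hle
      · exact (hinj_aux b hb a ha hbp hap h.symm hle).symm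
  · intro a ha b hb c hc hab hbc
    have hbp : b ≠ p := by
      rintro rfl
      simp only [if_true] at hab
      split_ifs at hab with h
      · exact lt_irrefl _ hab
      · exact lt_asymm hab (hM a ha)
    have hcp : c ≠ p := by
      rintro rfl
      simp only [if_true, hbp, if_false] at hbc
      exact lt_asymm hbc (hM b hb)
    have hbc' : K b / F b < K c / F c := by simpa [hbp, hcp] using hbc
    by_cases hap : a = p
    · rw [hap]; exact hlt b hb c hc hbp hcp hbc'
    · have hab' : K a / F a < K b / F b := by simpa [hap, hbp] using hab
      exact hV.orient_pos hp ha hb hc (Ne.symm hbp) (by rintro rfl; exact lt_irrefl _ hab)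
        (by rintro rfl; exact lt_irrefl _ hbc)
        (hlt a ha b hb hap hbp hab') (hlt b hb c hc hbp hcp hbc')
        (hlt a ha c hc hap hcp (hab'.trans hbc'))

/-- Points in convex position can be enumerated counterclockwise. -/
theorem ConvexPos.exists_enum {V : Finset Pt} (hV : ConvexPos V) (hne : V.Nonempty) :
    ∃ e : ℕ → Pt, (∀ i < V.card, e i ∈ V) ∧ (∀ v ∈ V, ∃ i < V.card, e i = v) ∧
      (∀ i < V.card, ∀ j < V.card, e i = e j → i = j) ∧
      ∀ i j l, i < j → j < l → l < V.card → 0 < orient (e i) (e j) (e l) := by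
  obtain ⟨φ, hinj, hφ⟩ := hV.exists_key hne
  have hcard : (V.image φ).card = V.card := Finset.card_image_of_injOn hinj
  set g := (V.image φ).orderEmbOfFin hcard with hg
  have hex : ∀ i : Fin V.card, ∃ v ∈ V, φ v = g i := fun i =>
    Finset.mem_image.1 (Finset.orderEmbOfFin_mem _ hcard i)
  choose e heV heφ using hex
  have hlt : ∀ i j : Fin V.card, i < j → φ (e i) < φ (e j) := fun i j h => by
    rw [heφ, heφ]; exact g.strictMono h
  refine ⟨fun i => if h : i < V.card then e ⟨i, h⟩ else 0, ?_, ?_, ?_, ?_⟩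
  · intro i hi; simp only [hi, dif_pos]; exact heV _
  · intro v hv
    have : φ v ∈ Set.range g := by
      rw [hg, Finset.range_orderEmbOfFin]
      exact Finset.mem_coe.2 (Finset.mem_image_of_mem φ hv)
    obtain ⟨i, hi⟩ := this
    refine ⟨i, i.2, ?_⟩
    simp only [i.2, dif_pos]
    exact hinj (heV i) hv (by rw [heφ, hi])
  · intro i hi j hj h
    simp only [hi, hj, dif_pos] at h
    have := congrArg φ h
    rw [heφ, heφ] at this
    simpa using g.injective this
  · intro i j l hij hjl hl
    have hj := hjl.trans hl
    have hi := hij.trans hj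
    simp only [hi, hj, hl, dif_pos]
    exact hφ _ (heV _) _ (heV _) _ (heV _) (hlt _ _ hij) (hlt _ _ hjl)

theorem two_mul_sum_min (s y : ℕ) :
    2 * ∑ r ∈ Finset.range (s + y), min (r + 1) s + s * s = 2 * s * (s + y) + s := by
  induction y with
  | zero =>
    have h : ∑ r ∈ Finset.range s, min (r + 1) s = ∑ r ∈ Finset.range s, (r + 1) :=
      Finset.sum_congr rfl fun r hr => min_eq_left (Finset.mem_range.1 hr)
    have h2 := Finset.sum_range_id_mul_two (s + 1)
    rw [Finset.sum_range_succ'] at h2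
    simp only [add_zero, Nat.add_sub_cancel] at h2
    rw [add_zero, h]
    nlinarith
  | succ y ih =>
    rw [← add_assoc, Finset.sum_range_succ, min_eq_right (by omega)]
    nlinarith

/-- A graph on the ordered set `0, …, n - 1` in which every edge `ij` is crossed by at most `k`
edges has a vertex of degree at most `2 √(k + 1) + 1`. -/
theorem exists_degree_le_of_crossings {n k : ℕ} (hn : 0 < n) (A : ℕ → ℕ → Prop)
    (hsymm : ∀ i j, A i j → A j i) (hirr : ∀ i, ¬ A i i) (hlt : ∀ i j, A i j → j < n)
    (hA : ∀ i j, i < j → A i j → ((Finset.Ioo i j ×ˢ Finset.range n).filter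
      fun q => A q.1 q.2 ∧ (q.2 < i ∨ j < q.2)).card ≤ k) :
    ∃ v < n, (((Finset.range n).filter (A v)).card : ℝ) ≤ 2 * Real.sqrt (k + 1) + 1 := by
  set a := Real.sqrt (k + 1) with ha
  have ha2 : a ^ 2 = k + 1 := Real.sq_sqrt (by positivity)
  have ha0 : 0 ≤ a := Real.sqrt_nonneg _
  set s := Nat.sqrt (k + 1) with hs
  have hsa : (s : ℝ) ≤ a := by
    apply Real.le_sqrt_of_sq_le
    exact_mod_cast Nat.sqrt_le' (k + 1)
  have has : a < s + 1 := by
    rw [ha, Real.sqrt_lt' (by positivity)]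
    exact_mod_cast Nat.lt_succ_sqrt' (k + 1)
  by_cases hlong : ∃ d, s < d ∧ ∃ i, A i (i + d)
  swap
  · refine ⟨0, hn, ?_⟩
    have hsub : (Finset.range n).filter (A 0) ⊆ Finset.Ioc 0 s := by
      intro w hw
      rw [Finset.mem_filter] at hw
      rw [Finset.mem_Ioc]
      refine ⟨Nat.pos_of_ne_zero ?_, ?_⟩
      · rintro rfl; exact hirr _ hw.2
      · by_contra! h
        exact hlong ⟨w, h, 0, by simpa using hw.2⟩
    have := Finset.card_le_card hsub
    rw [Nat.card_Ioc] at this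
    have : (((Finset.range n).filter (A 0)).card : ℝ) ≤ s := by exact_mod_cast this
    linarith
  obtain ⟨hsd, i, hi⟩ := Nat.find_spec hlong
  have hmin := fun m => Nat.find_min hlong (m := m)
  set d := Nat.find hlong with hd
  have hshort : ∀ u w, A u w → i ≤ u → u < w → w ≤ i + d → w - u < d → w ≤ u + s := by
    intro u w hA' _ huw _ hlt'
    by_contra! h
    exact hmin (w - u) hlt' ⟨by omega, u, by rwa [Nat.add_sub_cancel' huw.le]⟩
  obtain ⟨y, hy⟩ : ∃ y, d = s + y + 1 := ⟨d - s - 1, by omega⟩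
  by_contra! hdeg
  have hinn : ∀ r ∈ Finset.range (s + y),
      ((Finset.range n).filter (A (i + 1 + r))).card ≤
        ((Finset.range n).filter fun w => A (i + 1 + r) w ∧ (w < i ∨ i + d < w)).card +
          (min (r + 1) s + min (s + y - 1 - r + 1) s) := by
    intro r hr
    rw [Finset.mem_range] at hr
    have hsub : (Finset.range n).filter (A (i + 1 + r)) ⊆
        ((Finset.range n).filter fun w => A (i + 1 + r) w ∧ (w < i ∨ i + d < w)) ∪
          (Finset.Ico (i + 1 + r - min (r + 1) s) (i + 1 + r) ∪
            Finset.Ioc (i + 1 + r) (i + 1 + r + min (s + y - 1 - r + 1) s)) := by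
      intro w hw
      rw [Finset.mem_filter] at hw
      rw [Finset.mem_union, Finset.mem_union, Finset.mem_filter, Finset.mem_Ico, Finset.mem_Ioc]
      by_cases hout : w < i ∨ i + d < w
      · exact Or.inl ⟨hw.1, hw.2, hout⟩
      · right
        rcases lt_trichotomy w (i + 1 + r) with h | h | h
        · left
          have := hshort w _ (hsymm _ _ hw.2) (by omega) h (by omega) (by omega)
          omega
        · exact absurd (h ▸ hw.2) (hirr _)
        · right
          have := hshort _ w hw.2 (by omega) h (by omega) (by omega)
          omega
    refine (Finset.card_le_card hsub).trans ((Finset.card_union_le _ _).trans ?_)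
    refine Nat.add_le_add_left ((Finset.card_union_le _ _).trans ?_) _
    rw [Nat.card_Ico, Nat.card_Ioc]
    omega
  have hsum := Finset.sum_le_sum hinn
  rw [Finset.sum_add_distrib, Finset.sum_add_distrib,
    Finset.sum_range_reflect (fun r => min (r + 1) s)] at hsum
  have hcross : ∑ r ∈ Finset.range (s + y),
      ((Finset.range n).filter fun w => A (i + 1 + r) w ∧ (w < i ∨ i + d < w)).card ≤ k := by
    refine le_trans (le_of_eq ?_) (hA i (i + d) (by omega) hi)
    rw [Finset.card_filter, Finset.sum_product]
    simp only [Finset.card_filter]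
    rw [← Finset.Ico_succ_left_eq_Ioo, Finset.sum_Ico_eq_sum_range]
    have : i + d - Order.succ i = s + y := by simp only [Nat.succ_eq_succ]; omega
    rw [this]
    rfl
  have hmins := two_mul_sum_min s y
  have hlow : ((s + y : ℕ) : ℝ) * (2 * a + 1) ≤
      ∑ r ∈ Finset.range (s + y), (((Finset.range n).filter (A (i + 1 + r))).card : ℝ) := by
    have := Finset.card_nsmul_le_sum (Finset.range (s + y))
      (fun r => (((Finset.range n).filter (A (i + 1 + r))).card : ℝ)) (2 * a + 1)
      (fun r hr => (hdeg _ (by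
        have := hlt _ _ hi
        rw [Finset.mem_range] at hr
        omega)).le)
    simpa only [Finset.card_range, nsmul_eq_mul] using this
  have hup : ∑ r ∈ Finset.range (s + y), (((Finset.range n).filter (A (i + 1 + r))).card : ℝ) +
      s * s ≤ k + (2 * s * (s + y) + s) := by
    have : ∑ r ∈ Finset.range (s + y), ((Finset.range n).filter (A (i + 1 + r))).card +
      s * s ≤ k + (2 * s * (s + y) + s) := by omega
    exact_mod_cast this
  push_cast at hlow
  have hy0 : (0 : ℝ) ≤ y := by positivity
  nlinarith [mul_nonneg hy0 (by linarith : (0 : ℝ) ≤ 2 * a + 1 - 2 * s),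
    mul_pos (by linarith : 0 < 1 - (a - s)) (by linarith : 0 < 1 + (a - s))]

/-- An outer `k`-planar graph has a vertex of degree at most `2 √(k + 1) + 1`. -/
theorem OuterKPlanar.exists_degree_le {k : ℕ} {G : ConvexGeomGraph} (hG : OuterKPlanar G k)
    (hne : G.V.Nonempty) : ∃ v ∈ G.V, (degree G v : ℝ) ≤ 2 * Real.sqrt (k + 1) + 1 := by
  obtain ⟨e, heV, hsurj, hinj, hor⟩ := G.convexPos.exists_enum hne
  set n := G.V.card with hn
  have hcr : ∀ i j l m, i < j → j < l → l < m → m < n →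
      Cross s(e i, e l) s(e j, e m) := by
    intro i j l m hij hjl hlm hm
    refine ⟨?_, openSegment_inter_nonempty (hor i j l hij hjl (by omega))
      (hor i j m hij (by omega) hm) (hor i l m (by omega) hlm hm) (hor j l m hjl hlm hm)⟩
    intro h
    rcases Sym2.eq_iff.1 h with ⟨h, -⟩ | ⟨h, -⟩
    · have := hinj _ (by omega) _ (by omega) h; omega
    · have := hinj _ (by omega) _ (by omega) h; omega
  obtain ⟨v, hv, hdeg⟩ := exists_degree_le_of_crossings (n := n) (k := k)
    (Finset.card_pos.2 hne) (fun i j => i < n ∧ j < n ∧ s(e i, e j) ∈ G.E)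
    (fun i j h => ⟨h.2.1, h.1, by rw [Sym2.eq_swap]; exact h.2.2⟩)
    (fun i h => G.not_diag _ h.2.2 rfl) (fun i j h => h.2.1) (by
      rintro i j hij ⟨hi, hj, hE⟩
      refine le_trans (Finset.card_le_card_of_injOn (fun q => s(e q.1, e q.2)) ?_ ?_)
        (hG _ hE)
      · rintro ⟨u, w⟩ hq
        simp only [Finset.coe_filter, Finset.mem_product, Finset.mem_Ioo, Set.mem_ofPred_eq] at hq
        obtain ⟨⟨⟨h1, h2⟩, -⟩, ⟨hu, hw, hE'⟩, h | h⟩ := hq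
        · simp only [Finset.coe_filter, Set.mem_ofPred_eq]
          refine ⟨hE', (Cross_comm _ _).1 ?_⟩
          rw [Sym2.eq_swap]
          exact hcr w i u j h h1 h2 hj
        · simp only [Finset.coe_filter, Set.mem_ofPred_eq]
          exact ⟨hE', hcr i u j w h1 h2 h hw⟩
      · rintro ⟨u, w⟩ hq ⟨u', w'⟩ hq' h
        simp only [Finset.coe_filter, Finset.mem_product, Finset.mem_Ioo,
          Set.mem_ofPred_eq] at hq hq'
        obtain ⟨h1, ⟨hu, hw, -⟩, h2⟩ := hq
        obtain ⟨h1', ⟨hu', hw', -⟩, h2'⟩ := hq'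
        rcases Sym2.eq_iff.1 h with ⟨ha, hb⟩ | ⟨ha, hb⟩
        · rw [hinj _ hu _ hu' ha, hinj _ hw _ hw' hb]
        · have := hinj _ hu _ hw' ha
          omega)
  refine ⟨e v, heV v hv, le_trans ?_ hdeg⟩
  norm_cast
  refine Finset.card_le_card_of_surjOn (fun w => s(e v, e w)) ?_
  intro f hf
  simp only [Finset.coe_filter, Set.mem_ofPred_eq] at hf
  obtain ⟨w, rfl⟩ := Sym2.mem_iff_exists.1 hf.2
  obtain ⟨j, hj, rfl⟩ := hsurj w (G.mem_V _ hf.1 w (Sym2.mem_mk_right _ _))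
  exact ⟨j, by simp [hj, hv, hf.1], rfl⟩

/-- The convex geometric graph obtained by deleting a vertex. -/
noncomputable def ConvexGeomGraph.deleteVertex (G : ConvexGeomGraph) (v : Pt) :
    ConvexGeomGraph where
  V := G.V.erase v
  E := G.E.filter (fun e => v ∉ e)
  convexPos := G.convexPos.mono (Finset.erase_subset _ _)
  not_diag e he := G.not_diag e (Finset.mem_filter.1 he).1
  mem_V e he p hp := by
    rw [Finset.mem_filter] at he
    exact Finset.mem_erase.2 ⟨by rintro rfl; exact he.2 hp, G.mem_V e he.1 p hp⟩

theorem OuterKPlanar.deleteVertex {k : ℕ} {G : ConvexGeomGraph} (hG : OuterKPlanar G k)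
    (v : Pt) : OuterKPlanar (G.deleteVertex v) k := fun e he =>
  (Finset.card_le_card (Finset.filter_subset_filter _ (Finset.filter_subset _ _))).trans
    (hG e (Finset.mem_filter.1 he).1)

theorem ConvexGeomGraph.card_deleteVertex_add_degree (G : ConvexGeomGraph) (v : Pt) :
    (G.deleteVertex v).E.card + degree G v = G.E.card := by
  rw [add_comm]
  exact Finset.card_filter_add_card_filter_not (fun e => v ∈ e)

/-- every outer k-planar graph on n vertices has at most
(2·√(k+1) + 2)·n edges. -/
theorem stmt7 (k : ℕ) (G : ConvexGeomGraph) (hG : OuterKPlanar G k) :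
    (G.E.card : ℝ) ≤ (2 * Real.sqrt (k + 1) + 2) * G.V.card := by
  induction hn : G.V.card generalizing G with
  | zero =>
    have hE : G.E = ∅ := by
      refine Finset.eq_empty_of_forall_notMem fun e he => ?_
      have := G.mem_V e he _ e.out_fst_mem
      rw [Finset.card_eq_zero.1 hn] at this
      simp at this
    simp [hE]
  | succ m ih =>
    obtain ⟨v, hv, hdeg⟩ := hG.exists_degree_le (Finset.card_pos.1 (by omega))
    have h := ih (G.deleteVertex v) (hG.deleteVertex v)
      (by rw [ConvexGeomGraph.deleteVertex, Finset.card_erase_of_mem hv, hn]; rfl)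
    rw [← G.card_deleteVertex_add_degree v]
    push_cast
    linarith
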